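/- The difference between the modified and the classical Richards curves is strictly increasing after the switching time: for every t > t*, d/dt [x̃_θ(t) − x_θ(t)] = x_θ(t)·[h̃_θ(t)·exp(∫_{t*}^{t} C(s)·k^s·|log k|/(η+k^s) ds) − h_θ(t)] > 0. -/

import Mathlib

/-- The fundamental theorem of calculus for a function continuous on a closed half-line. -/
theorem hasDerivAt_integral_of_continuousOn_Ici {g : ℝ → ℝ} {a t : ℝ}
    (hg : ContinuousOn g (Set.Ici a)) (hat : a < t) :
    HasDerivAt (fun u => ∫ s in a..u, g s) (g t) t := by
  have hmem : Set.Ici a ∈ nhds t := Ici_mem_nhds hat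
  refine intervalIntegral.integral_hasDerivAt_right ?_ ?_ (hg.continuousAt hmem)
  · refine (hg.mono fun s hs => ?_).intervalIntegrable
    rw [Set.uIcc_of_le hat.le] at hs
    exact hs.1
  · exact ⟨Set.Ici a, hmem, hg.aestronglyMeasurable measurableSet_Ici⟩

/-- The Richards curve solves `x' = h x`, where `h` is its growth rate. -/
theorem hasDerivAt_richards {k η A : ℝ} (x0 q : ℝ) (hk0 : 0 < k) (hk1 : k < 1) (hη : 0 < η)
    (hA : 0 < A) (t : ℝ) :
    HasDerivAt (fun u => x0 * (A / (η + k ^ u)) ^ q)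
      (x0 * (A / (η + k ^ t)) ^ q * (q * k ^ t * |Real.log k| / (η + k ^ t))) t := by
  have hkt : 0 < k ^ t := Real.rpow_pos_of_pos hk0 t
  have hden : 0 < η + k ^ t := by positivity
  have hpow : HasDerivAt (fun u : ℝ => k ^ u) (Real.log k * 1 * k ^ t) t :=
    (hasDerivAt_id t).const_rpow hk0
  have hbase := (hasDerivAt_const t A).fun_div (hpow.const_add η) hden.ne'
  have hcurve := (hbase.rpow_const (p := q) (Or.inl (div_pos hA hden).ne')).const_mul x0
  refine hcurve.congr_deriv ?_
  rw [Real.rpow_sub_one (div_pos hA hden).ne', abs_of_neg (Real.log_neg hk0 hk1)]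
  field_simp
  ring


/-- The difference between the modified and the classical Richards curves is strictly
increasing after the switching time: for every `t > tstar`,
`d/dt [xt t - x t] = x t * (ht t * exp(∫_{tstar}^t C s * k^s * |log k| / (η + k^s) ds) - h t) > 0`. -/
theorem stmt_13 (q k η x0 t0 tstar : ℝ) (hq : 0 < q) (hk0 : 0 < k) (hk1 : k < 1)
    (hη : 0 < η) (hx0 : 0 < x0) (htstar : t0 ≤ tstar)
    (C : ℝ → ℝ)
    (hC_cont : ContinuousOn C (Set.Ici tstar))
    (hC_bdd : ∃ M : ℝ, ∀ t, tstar ≤ t → |C t| ≤ M)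
    (hC_pos : ∀ t, tstar < t → 0 < C t)
    (hC_zero : C tstar = 0)
    (x h qt ht xt : ℝ → ℝ)
    (hx : ∀ t, x t = x0 * ((η + k ^ t0) / (η + k ^ t)) ^ q)
    (hh : ∀ t, h t = q * (k ^ t) * |Real.log k| / (η + k ^ t))
    (hqt : ∀ t, qt t = if t ≤ tstar then q else q + C t)
    (hht : ∀ t, ht t = qt t * (k ^ t) * |Real.log k| / (η + k ^ t))
    (hxt : ∀ t, xt t =
      x t * Real.exp (∫ s in tstar..max t tstar, C s * (k ^ s) * |Real.log k| / (η + k ^ s))) :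
    ∀ t, tstar < t →
      HasDerivAt (fun u => xt u - x u)
        (x t * (ht t * Real.exp (∫ s in tstar..t, C s * (k ^ s) * |Real.log k| / (η + k ^ s))
          - h t)) t ∧
      0 < x t * (ht t * Real.exp (∫ s in tstar..t, C s * (k ^ s) * |Real.log k| / (η + k ^ s))
          - h t) := by
  intro t ht_lt
  set g : ℝ → ℝ := fun s => C s * (k ^ s) * |Real.log k| / (η + k ^ s) with hg
  have hpow_pos (s : ℝ) : 0 < k ^ s := Real.rpow_pos_of_pos hk0 s
  have hden (s : ℝ) : 0 < η + k ^ s := add_pos hη (hpow_pos s)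
  have hlog : 0 < |Real.log k| := abs_pos.mpr (Real.log_neg hk0 hk1).ne
  have hpow_cont : Continuous fun s : ℝ => k ^ s := Real.continuous_const_rpow hk0.ne'
  have hg_cont : ContinuousOn g (Set.Ici tstar) :=
    ((hC_cont.mul hpow_cont.continuousOn).mul continuousOn_const).div
      (continuous_const.add hpow_cont).continuousOn fun s _ => (hden s).ne'
  have hg_nonneg (s : ℝ) (hs : tstar ≤ s) : 0 ≤ g s := by
    have hC : 0 ≤ C s := hs.eq_or_lt.elim (fun h => h ▸ hC_zero.ge) fun h => (hC_pos s h).le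
    exact div_nonneg (mul_nonneg (mul_nonneg hC (hpow_pos s).le) hlog.le) (hden s).le
  have hx_deriv : HasDerivAt x (x t * h t) t := by
    rw [funext hx, hh]
    exact hasDerivAt_richards x0 q hk0 hk1 hη (hden t0) t
  have hht_eq : ht t = h t + g t := by
    rw [hht, hqt, if_neg ht_lt.not_ge, hh]
    ring
  constructor
  · have hexp := (hasDerivAt_integral_of_continuousOn_Ici hg_cont ht_lt).exp
    have hxt_eq : xt =ᶠ[nhds t] fun u => x u * Real.exp (∫ s in tstar..u, g s) := by
      filter_upwards [Ioi_mem_nhds ht_lt] with u hu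
      rw [hxt, max_eq_left (le_of_lt hu)]
    refine (((hx_deriv.mul hexp).congr_of_eventuallyEq hxt_eq).sub hx_deriv).congr_deriv ?_
    rw [hht_eq]
    ring
  · have hx_pos : 0 < x t := by
      rw [hx]
      exact mul_pos hx0 (Real.rpow_pos_of_pos (div_pos (hden t0) (hden t)) q)
    have hg_pos : 0 < g t :=
      div_pos (mul_pos (mul_pos (hC_pos t ht_lt) (hpow_pos t)) hlog) (hden t)
    have hh_pos : 0 < h t := by
      rw [hh]
      exact div_pos (mul_pos (mul_pos hq (hpow_pos t)) hlog) (hden t)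
    have hexp : 1 ≤ Real.exp (∫ s in tstar..t, g s) :=
      Real.one_le_exp (intervalIntegral.integral_nonneg ht_lt.le fun s hs => hg_nonneg s hs.1)
    refine mul_pos hx_pos (sub_pos.mpr ?_)
    rw [hht_eq]
    exact (lt_add_of_pos_right _ hg_pos).trans_le
      (le_mul_of_one_le_right (add_pos hh_pos hg_pos).le hexp)
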